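/- (Normalized LANSIT) Let L be a complete leaf set over a finite alphabet Z with branching set B, let P_Y be a probability distribution on L with node probabilities Q and branching distributions P_{Y_t}, and let P_B(t) := Q(t)/E[ℓ(Y)] for t ∈ B. Then for any real-valued function f on the nodes B ∪ L of the tree, (E[f(Y)] − f(ε)) / E[ℓ(Y)] = Σ_{t ∈ B} P_B(t) Σ_{z ∈ Z} P_{Y_t}(z) (f(tz) − f(t)), where E[f(Y)] := Σ_{t ∈ L} P_Y(t) f(t) and terms with Q(t) = 0 are taken to be 0. -/

import Mathlib

open Finset

noncomputable section

/-- A finite set of nonempty strings over `Z` is a *complete leaf set* if it is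
prefix-free and every sufficiently long string over `Z` has exactly one prefix in it
(equivalently, it is the leaf set of a finite rooted tree in which every branching
node has exactly `|Z|` children, one per letter). -/
def IsCompleteLeafSet {Z : Type*} (L : Finset (List Z)) : Prop :=
  (∀ t ∈ L, t ≠ []) ∧
  (∀ s ∈ L, ∀ t ∈ L, s <+: t → s = t) ∧
  (∃ N : ℕ, ∀ s : List Z, N ≤ s.length → ∃! t, t ∈ L ∧ t <+: s)

/-- The branching set: all proper prefixes of leaves, including the root `[]`. -/
def branchSet {Z : Type*} [DecidableEq Z] (L : Finset (List Z)) : Finset (List Z) :=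
  L.biUnion fun t => (Finset.range t.length).image fun i => t.take i

/-- Node probability `Q(t)`: total probability of the leaves having `t` as a prefix. -/
def nodeProb {Z : Type*} [DecidableEq Z] (L : Finset (List Z)) (P : List Z → ℝ)
    (t : List Z) : ℝ :=
  ∑ s ∈ L.filter (fun s => t <+: s), P s

/-- Branching distribution `P_{Y_t}(z) = Q(tz)/Q(t)` (junk value `0` when `Q(t) = 0`,
so that terms with `Q(t) = 0` vanish). -/
def branchDist {Z : Type*} [DecidableEq Z] (L : Finset (List Z)) (P : List Z → ℝ)
    (t : List Z) (z : Z) : ℝ :=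
  nodeProb L P (t ++ [z]) / nodeProb L P t

/-- Expected leaf depth `E[ℓ(Y)]`. -/
def expLen {Z : Type*} (L : Finset (List Z)) (P : List Z → ℝ) : ℝ :=
  ∑ t ∈ L, P t * t.length

/-- Shannon entropy in bits of `P` on the finite set `S` (terms with `P x = 0` vanish). -/
def ent {α : Type*} (S : Finset α) (P : α → ℝ) : ℝ :=
  ∑ x ∈ S, -(P x * Real.logb 2 (P x))

/-- Informational divergence in bits of `P` from `P'` on `S` (terms with `P x = 0` vanish). -/
def kl {α : Type*} (S : Finset α) (P P' : α → ℝ) : ℝ :=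
  ∑ x ∈ S, P x * Real.logb 2 (P x / P' x)

/-- The leaf distribution induced by a memoryless source: `P_Z^L(t) = ∏ i, P_Z(t_i)`. -/
def inducedProb {Z : Type*} (P : Z → ℝ) (t : List Z) : ℝ :=
  (t.map P).prod

/-- `L¹` (total variation) distance between two distributions on a finite alphabet. -/
def l1dist {Z : Type*} [Fintype Z] (P P' : Z → ℝ) : ℝ :=
  ∑ z, |P z - P' z|

theorem lansit_single {Z : Type*} [Fintype Z] [DecidableEq Z]
    (L : Finset (List Z)) (f : List Z → ℝ) (s : List Z) (hs : s ∈ L) :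
    ∑ t ∈ branchSet L, ∑ z : Z, (if t ++ [z] <+: s then f (t ++ [z]) - f t else 0)
      = f s - f [] := by
  have hsub : (Finset.range s.length).image (fun i => s.take i) ⊆ branchSet L := by
    intro t ht
    exact Finset.mem_biUnion.2 ⟨s, hs, ht⟩
  rw [← Finset.sum_subset hsub]
  · rw [Finset.sum_image]
    · have key : ∀ i ∈ Finset.range s.length,
          (∑ z : Z, (if s.take i ++ [z] <+: s then f (s.take i ++ [z]) - f (s.take i) else 0))
            = f (s.take (i + 1)) - f (s.take i) := by
        intro i hi
        have hi' : i < s.length := Finset.mem_range.1 hi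
        have hcat : s.take i ++ [s[i]] = s.take (i + 1) := by simp
        rw [Finset.sum_eq_single s[i]]
        · rw [hcat, if_pos (List.take_prefix _ _)]
        · intro z _ hz
          rw [if_neg]
          intro hp
          apply hz
          have h1 := List.prefix_iff_eq_take.1 hp
          have hl : (s.take i ++ [z]).length = i + 1 := by simp; omega
          rw [hl, ← hcat] at h1
          exact (List.cons.inj (List.append_cancel_left h1)).1
        · intro h
          exact absurd (Finset.mem_univ _) h
      rw [Finset.sum_congr rfl key, Finset.sum_range_sub (fun i => f (s.take i))]
      simp
    · intro i hi j hj hij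
      have hi' : i < s.length := by simpa using hi
      have hj' : j < s.length := by simpa using hj
      have := congrArg List.length hij
      simp at this
      omega
  · intro t _ ht
    apply Finset.sum_eq_zero
    intro z _
    rw [if_neg]
    intro hp
    apply ht
    have h1 : t <+: s := (List.prefix_append t [z]).trans hp
    have h2 := hp.length_le
    simp at h2
    exact Finset.mem_image.2 ⟨t.length, Finset.mem_range.2 (by omega),
      (List.prefix_iff_eq_take.1 h1).symm⟩

theorem nodeProb_mul_branchDist {Z : Type*} [DecidableEq Z]
    (L : Finset (List Z)) (P : List Z → ℝ) (hPnn : ∀ t ∈ L, 0 ≤ P t) (t : List Z) (z : Z) :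
    nodeProb L P t * branchDist L P t z = nodeProb L P (t ++ [z]) := by
  unfold branchDist
  by_cases h : nodeProb L P t = 0
  · rw [h, zero_mul]
    unfold nodeProb at h ⊢
    rw [Finset.sum_eq_zero_iff_of_nonneg
      (fun s hs => hPnn s (Finset.mem_filter.1 hs).1)] at h
    symm
    apply Finset.sum_eq_zero
    intro s hs
    rw [Finset.mem_filter] at hs
    exact h s (Finset.mem_filter.2 ⟨hs.1, (List.prefix_append t [z]).trans hs.2⟩)
  · field_simp

/-- **Normalized LANSIT.**
`(E[f(Y)] − f(ε))/E[ℓ(Y)] = Σ_{t ∈ B} P_B(t) Σ_{z ∈ Z} P_{Y_t}(z)(f(tz) − f(t))`,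
where `P_B(t) = Q(t)/E[ℓ(Y)]` and terms with `Q(t) = 0` are taken to be `0`. -/
theorem normalized_lansit {Z : Type*} [Fintype Z] [DecidableEq Z]
    (L : Finset (List Z)) (hL : IsCompleteLeafSet L)
    (hZ : 2 ≤ Fintype.card Z)
    (P : List Z → ℝ) (hPnn : ∀ t ∈ L, 0 ≤ P t) (hPsum : ∑ t ∈ L, P t = 1)
    (f : List Z → ℝ) :
    ((∑ t ∈ L, P t * f t) - f []) / expLen L P =
      ∑ t ∈ branchSet L, (nodeProb L P t / expLen L P) *
        ∑ z : Z, branchDist L P t z * (f (t ++ [z]) - f t) := by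
  have hmain : (∑ t ∈ L, P t * f t) - f [] =
      ∑ t ∈ branchSet L, ∑ z : Z, nodeProb L P (t ++ [z]) * (f (t ++ [z]) - f t) := by
    have h1 : (∑ t ∈ L, P t * f t) - f [] = ∑ s ∈ L, P s * (f s - f []) := by
      simp_rw [mul_sub]
      rw [Finset.sum_sub_distrib, ← Finset.sum_mul, hPsum, one_mul]
    rw [h1, Finset.sum_congr rfl (fun s hs => by rw [← lansit_single L f s hs])]
    simp_rw [Finset.mul_sum]
    rw [Finset.sum_comm]
    refine Finset.sum_congr rfl fun t _ => ?_
    rw [Finset.sum_comm]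
    refine Finset.sum_congr rfl fun z _ => ?_
    unfold nodeProb
    rw [Finset.sum_mul, Finset.sum_filter]
    refine Finset.sum_congr rfl fun s _ => ?_
    split_ifs <;> simp
  rw [hmain, Finset.sum_div]
  refine Finset.sum_congr rfl fun t _ => ?_
  rw [Finset.mul_sum, Finset.sum_div]
  refine Finset.sum_congr rfl fun z _ => ?_
  rw [← nodeProb_mul_branchDist L P hPnn t z]
  ring
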